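/- The point symmetry fields of the KP equation close into a Lie algebra: for any smooth functions f₁, g₁, h₁, k₁, ℓ₁ and f₂, g₂, h₂, k₂, ℓ₂ from ℝ to ℝ, there exist smooth functions f₃, g₃, h₃, k₃, ℓ₃ : ℝ → ℝ such that the Lie bracket of V₁ = T(f₁) + Y(g₁) + X(h₁) + W(k₁) + U(ℓ₁) and V₂ = T(f₂) + Y(g₂) + X(h₂) + W(k₂) + U(ℓ₂) equals T(f₃) + Y(g₃) + X(h₃) + W(k₃) + U(ℓ₃) pointwise; in particular the symmetry algebra is a semidirect sum of the Virasoro algebra {T(f)} and the nilpotent algebra {Y(g), X(h), W(k), U(ℓ)}. -/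

import Mathlib

noncomputable section

/-- The space ℝ⁴, with coordinates (x, y, t, w). -/
abbrev E : Type := ℝ × ℝ × ℝ × ℝ

/-- Lie bracket of vector fields on ℝ⁴:
`[V, W](p) = DW(p)(V(p)) − DV(p)(W(p))`. -/
def lie (V W : E → E) : E → E :=
  fun p => fderiv ℝ W p (V p) - fderiv ℝ V p (W p)

/-- The Virasoro vector field `T(f)`. -/
def Tf (f : ℝ → ℝ) : E → E := fun p =>
  ((1/3) * p.1 * deriv f p.2.2.1 + (2/9) * p.2.1 ^ 2 * deriv (deriv f) p.2.2.1,
   (2/3) * p.2.1 * deriv f p.2.2.1,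
   f p.2.2.1,
   -((1/3) * p.2.2.2 * deriv f p.2.2.1 + (1/9) * p.1 ^ 2 * deriv (deriv f) p.2.2.1
     + (4/27) * p.1 * p.2.1 ^ 2 * deriv (deriv (deriv f)) p.2.2.1
     + (4/243) * p.2.1 ^ 4 * deriv (deriv (deriv (deriv f))) p.2.2.1))

/-- The Kac–Moody vector field `Y(g)`. -/
def Yf (g : ℝ → ℝ) : E → E := fun p =>
  ((2/3) * p.2.1 * deriv g p.2.2.1,
   g p.2.2.1,
   0,
   -((4/9) * p.1 * p.2.1 * deriv (deriv g) p.2.2.1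
     + (8/81) * p.2.1 ^ 3 * deriv (deriv (deriv g)) p.2.2.1))

/-- The Kac–Moody vector field `X(h)`. -/
def Xf (h : ℝ → ℝ) : E → E := fun p =>
  (h p.2.2.1, 0, 0, -((2/3) * p.1 * deriv h p.2.2.1 + (4/9) * p.2.1 ^ 2 * deriv (deriv h) p.2.2.1))

/-- The Kac–Moody vector field `W(k)`. -/
def Wf (k : ℝ → ℝ) : E → E := fun p =>
  (0, 0, 0, p.2.1 * k p.2.2.1)

/-- The Kac–Moody vector field `U(ℓ)`. -/
def Uf (l : ℝ → ℝ) : E → E := fun p =>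
  (0, 0, 0, l p.2.2.1)

@[fun_prop]
theorem ContDiff.deriv_infty {f : ℝ → ℝ} (hf : ContDiff ℝ (⊤ : ℕ∞) f) :
    ContDiff ℝ (⊤ : ℕ∞) (deriv f) :=
  (contDiff_infty_iff_deriv.mp hf).2

theorem deriv_add_of_contDiff_infty {u v : ℝ → ℝ} (hu : ContDiff ℝ (⊤ : ℕ∞) u)
    (hv : ContDiff ℝ (⊤ : ℕ∞) v) (t : ℝ) :
    deriv (fun s => u s + v s) t = deriv u t + deriv v t :=
  deriv_fun_add (hu.differentiable (by simp) t) (hv.differentiable (by simp) t)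

theorem deriv_sub_of_contDiff_infty {u v : ℝ → ℝ} (hu : ContDiff ℝ (⊤ : ℕ∞) u)
    (hv : ContDiff ℝ (⊤ : ℕ∞) v) (t : ℝ) :
    deriv (fun s => u s - v s) t = deriv u t - deriv v t :=
  deriv_fun_sub (hu.differentiable (by simp) t) (hv.differentiable (by simp) t)

theorem deriv_mul_of_contDiff_infty {u v : ℝ → ℝ} (hu : ContDiff ℝ (⊤ : ℕ∞) u)
    (hv : ContDiff ℝ (⊤ : ℕ∞) v) (t : ℝ) :
    deriv (fun s => u s * v s) t = deriv u t * v t + u t * deriv v t :=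
  deriv_fun_mul (hu.differentiable (by simp) t) (hv.differentiable (by simp) t)

/-- The derivative of a smooth function composed with the projection to the coordinate `t`. -/
theorem ContDiff.hasFDerivAt_comp_t {f : ℝ → ℝ} (hf : ContDiff ℝ (⊤ : ℕ∞) f) (p : E) :
    HasFDerivAt (fun q : E => f q.2.2.1)
      (deriv f p.2.2.1 • ((ContinuousLinearMap.fst ℝ ℝ ℝ).comp
        ((ContinuousLinearMap.snd ℝ ℝ (ℝ × ℝ)).comp
          (ContinuousLinearMap.snd ℝ ℝ (ℝ × ℝ × ℝ))))) p :=
  HasDerivAt.comp_hasFDerivAt p ((hf.differentiable (by simp)) p.2.2.1).hasDerivAt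
    (ContinuousLinearMap.hasFDerivAt ((ContinuousLinearMap.fst ℝ ℝ ℝ).comp
        ((ContinuousLinearMap.snd ℝ ℝ (ℝ × ℝ)).comp
          (ContinuousLinearMap.snd ℝ ℝ (ℝ × ℝ × ℝ)))))

theorem hasFDerivAt_x (p : E) :
    HasFDerivAt (fun q : E => q.1) (ContinuousLinearMap.fst ℝ ℝ (ℝ × ℝ × ℝ)) p :=
  hasFDerivAt_fst

theorem hasFDerivAt_y (p : E) :
    HasFDerivAt (fun q : E => q.2.1) ((ContinuousLinearMap.fst ℝ ℝ (ℝ × ℝ)).comp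
      (ContinuousLinearMap.snd ℝ ℝ (ℝ × ℝ × ℝ))) p :=
  ContinuousLinearMap.hasFDerivAt ((ContinuousLinearMap.fst ℝ ℝ (ℝ × ℝ)).comp
      (ContinuousLinearMap.snd ℝ ℝ (ℝ × ℝ × ℝ)))

theorem hasFDerivAt_w (p : E) :
    HasFDerivAt (fun q : E => q.2.2.2) ((ContinuousLinearMap.snd ℝ ℝ ℝ).comp
      ((ContinuousLinearMap.snd ℝ ℝ (ℝ × ℝ)).comp
        (ContinuousLinearMap.snd ℝ ℝ (ℝ × ℝ × ℝ)))) p :=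
  ContinuousLinearMap.hasFDerivAt ((ContinuousLinearMap.snd ℝ ℝ ℝ).comp
      ((ContinuousLinearMap.snd ℝ ℝ (ℝ × ℝ)).comp
        (ContinuousLinearMap.snd ℝ ℝ (ℝ × ℝ × ℝ))))

theorem differentiable_Tf {f : ℝ → ℝ} (hf : ContDiff ℝ (⊤ : ℕ∞) f) :
    Differentiable ℝ (Tf f) := by
  unfold Tf
  fun_prop (disch := simp)

theorem differentiable_Yf {g : ℝ → ℝ} (hg : ContDiff ℝ (⊤ : ℕ∞) g) :
    Differentiable ℝ (Yf g) := by
  unfold Yf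
  fun_prop (disch := simp)

theorem differentiable_Xf {h : ℝ → ℝ} (hh : ContDiff ℝ (⊤ : ℕ∞) h) :
    Differentiable ℝ (Xf h) := by
  unfold Xf
  fun_prop (disch := simp)

theorem differentiable_Wf {k : ℝ → ℝ} (hk : ContDiff ℝ (⊤ : ℕ∞) k) :
    Differentiable ℝ (Wf k) := by
  unfold Wf
  fun_prop (disch := simp)

theorem differentiable_Uf {l : ℝ → ℝ} (hl : ContDiff ℝ (⊤ : ℕ∞) l) :
    Differentiable ℝ (Uf l) := by
  unfold Uf
  fun_prop (disch := simp)

theorem fderiv_Tf {f : ℝ → ℝ} (hf : ContDiff ℝ (⊤ : ℕ∞) f) (p v : E) :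
    fderiv ℝ (Tf f) p v =
      ((1/3) * (v.1 * deriv f p.2.2.1 + p.1 * (deriv^[2] f p.2.2.1 * v.2.2.1))
        + (2/9) * (2 * p.2.1 * v.2.1 * deriv^[2] f p.2.2.1
          + p.2.1 ^ 2 * (deriv^[3] f p.2.2.1 * v.2.2.1)),
       (2/3) * (v.2.1 * deriv f p.2.2.1 + p.2.1 * (deriv^[2] f p.2.2.1 * v.2.2.1)),
       deriv f p.2.2.1 * v.2.2.1,
       -((1/3) * (v.2.2.2 * deriv f p.2.2.1 + p.2.2.2 * (deriv^[2] f p.2.2.1 * v.2.2.1))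
        + (1/9) * (2 * p.1 * v.1 * deriv^[2] f p.2.2.1
          + p.1 ^ 2 * (deriv^[3] f p.2.2.1 * v.2.2.1))
        + (4/27) * (v.1 * p.2.1 ^ 2 * deriv^[3] f p.2.2.1
          + 2 * p.1 * p.2.1 * v.2.1 * deriv^[3] f p.2.2.1
          + p.1 * p.2.1 ^ 2 * (deriv^[4] f p.2.2.1 * v.2.2.1))
        + (4/243) * (4 * p.2.1 ^ 3 * v.2.1 * deriv^[4] f p.2.2.1
          + p.2.1 ^ 4 * (deriv^[5] f p.2.2.1 * v.2.2.1)))) := by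
  have h1 := hf.deriv_infty
  have h2 := h1.deriv_infty
  have h3 := h2.deriv_infty
  have h4 := h3.deriv_infty
  have H : HasFDerivAt (Tf f) _ p :=
    ((((hasFDerivAt_x p).const_mul (1/3)).mul (h1.hasFDerivAt_comp_t p)).add
      ((((hasFDerivAt_y p).pow 2).const_mul (2/9)).mul (h2.hasFDerivAt_comp_t p))).prodMk
    ((((hasFDerivAt_y p).const_mul (2/3)).mul (h1.hasFDerivAt_comp_t p)).prodMk
    ((hf.hasFDerivAt_comp_t p).prodMk
    ((((((hasFDerivAt_w p).const_mul (1/3)).mul (h1.hasFDerivAt_comp_t p)).add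
      ((((hasFDerivAt_x p).pow 2).const_mul (1/9)).mul (h2.hasFDerivAt_comp_t p))).add
      ((((hasFDerivAt_x p).const_mul (4/27)).mul ((hasFDerivAt_y p).pow 2)).mul
        (h3.hasFDerivAt_comp_t p))).add
      ((((hasFDerivAt_y p).pow 4).const_mul (4/243)).mul (h4.hasFDerivAt_comp_t p))).neg))
  rw [H.fderiv]
  ext <;> simp <;> ring

theorem fderiv_Yf {g : ℝ → ℝ} (hg : ContDiff ℝ (⊤ : ℕ∞) g) (p v : E) :
    fderiv ℝ (Yf g) p v =
      ((2/3) * (v.2.1 * deriv g p.2.2.1 + p.2.1 * (deriv^[2] g p.2.2.1 * v.2.2.1)),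
       deriv g p.2.2.1 * v.2.2.1,
       0,
       -((4/9) * (v.1 * p.2.1 * deriv^[2] g p.2.2.1 + p.1 * v.2.1 * deriv^[2] g p.2.2.1
          + p.1 * p.2.1 * (deriv^[3] g p.2.2.1 * v.2.2.1))
        + (8/81) * (3 * p.2.1 ^ 2 * v.2.1 * deriv^[3] g p.2.2.1
          + p.2.1 ^ 3 * (deriv^[4] g p.2.2.1 * v.2.2.1)))) := by
  have h1 := hg.deriv_infty
  have h2 := h1.deriv_infty
  have h3 := h2.deriv_infty
  have H : HasFDerivAt (Yf g) _ p :=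
    (((hasFDerivAt_y p).const_mul (2/3)).mul (h1.hasFDerivAt_comp_t p)).prodMk
    ((hg.hasFDerivAt_comp_t p).prodMk
    ((hasFDerivAt_const (0 : ℝ) p).prodMk
    (((((hasFDerivAt_x p).const_mul (4/9)).mul (hasFDerivAt_y p)).mul
        (h2.hasFDerivAt_comp_t p)).add
      ((((hasFDerivAt_y p).pow 3).const_mul (8/81)).mul (h3.hasFDerivAt_comp_t p))).neg))
  rw [H.fderiv]
  ext <;> simp <;> ring

theorem fderiv_Xf {h : ℝ → ℝ} (hh : ContDiff ℝ (⊤ : ℕ∞) h) (p v : E) :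
    fderiv ℝ (Xf h) p v =
      (deriv h p.2.2.1 * v.2.2.1, 0, 0,
       -((2/3) * (v.1 * deriv h p.2.2.1 + p.1 * (deriv^[2] h p.2.2.1 * v.2.2.1))
        + (4/9) * (2 * p.2.1 * v.2.1 * deriv^[2] h p.2.2.1
          + p.2.1 ^ 2 * (deriv^[3] h p.2.2.1 * v.2.2.1)))) := by
  have h1 := hh.deriv_infty
  have h2 := h1.deriv_infty
  have H : HasFDerivAt (Xf h) _ p :=
    (hh.hasFDerivAt_comp_t p).prodMk
    ((hasFDerivAt_const (0 : ℝ) p).prodMk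
    ((hasFDerivAt_const (0 : ℝ) p).prodMk
    ((((hasFDerivAt_x p).const_mul (2/3)).mul (h1.hasFDerivAt_comp_t p)).add
      ((((hasFDerivAt_y p).pow 2).const_mul (4/9)).mul (h2.hasFDerivAt_comp_t p))).neg))
  rw [H.fderiv]
  ext <;> simp
  ring

theorem fderiv_Wf {k : ℝ → ℝ} (hk : ContDiff ℝ (⊤ : ℕ∞) k) (p v : E) :
    fderiv ℝ (Wf k) p v =
      (0, 0, 0, v.2.1 * k p.2.2.1 + p.2.1 * (deriv k p.2.2.1 * v.2.2.1)) := by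
  have H : HasFDerivAt (Wf k) _ p :=
    (hasFDerivAt_const (0 : ℝ) p).prodMk
    ((hasFDerivAt_const (0 : ℝ) p).prodMk
    ((hasFDerivAt_const (0 : ℝ) p).prodMk ((hasFDerivAt_y p).mul (hk.hasFDerivAt_comp_t p))))
  rw [H.fderiv]
  ext <;> simp
  ring

theorem fderiv_Uf {l : ℝ → ℝ} (hl : ContDiff ℝ (⊤ : ℕ∞) l) (p v : E) :
    fderiv ℝ (Uf l) p v = (0, 0, 0, deriv l p.2.2.1 * v.2.2.1) := by
  have H : HasFDerivAt (Uf l) _ p :=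
    (hasFDerivAt_const (0 : ℝ) p).prodMk
    ((hasFDerivAt_const (0 : ℝ) p).prodMk
    ((hasFDerivAt_const (0 : ℝ) p).prodMk (hl.hasFDerivAt_comp_t p)))
  rw [H.fderiv]
  ext <;> simp

theorem fderiv_symmetryField {f g h k l : ℝ → ℝ}
    (hf : ContDiff ℝ (⊤ : ℕ∞) f) (hg : ContDiff ℝ (⊤ : ℕ∞) g) (hh : ContDiff ℝ (⊤ : ℕ∞) h)
    (hk : ContDiff ℝ (⊤ : ℕ∞) k) (hl : ContDiff ℝ (⊤ : ℕ∞) l) (p v : E) :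
    fderiv ℝ (fun q => Tf f q + Yf g q + Xf h q + Wf k q + Uf l q) p v =
      fderiv ℝ (Tf f) p v + fderiv ℝ (Yf g) p v + fderiv ℝ (Xf h) p v
        + fderiv ℝ (Wf k) p v + fderiv ℝ (Uf l) p v := by
  have H : HasFDerivAt (fun q => Tf f q + Yf g q + Xf h q + Wf k q + Uf l q) _ p :=
    (((((differentiable_Tf hf p).hasFDerivAt.add (differentiable_Yf hg p).hasFDerivAt).add
      (differentiable_Xf hh p).hasFDerivAt).add (differentiable_Wf hk p).hasFDerivAt).add
      (differentiable_Uf hl p).hasFDerivAt)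
  rw [H.fderiv]
  rfl

/-- The point symmetry fields of the KP equation close into a Lie algebra. -/
theorem stmt15 (f₁ g₁ h₁ k₁ l₁ f₂ g₂ h₂ k₂ l₂ : ℝ → ℝ)
    (hf₁ : ContDiff ℝ (⊤ : ℕ∞) f₁) (hg₁ : ContDiff ℝ (⊤ : ℕ∞) g₁) (hh₁ : ContDiff ℝ (⊤ : ℕ∞) h₁)
    (hk₁ : ContDiff ℝ (⊤ : ℕ∞) k₁) (hl₁ : ContDiff ℝ (⊤ : ℕ∞) l₁)
    (hf₂ : ContDiff ℝ (⊤ : ℕ∞) f₂) (hg₂ : ContDiff ℝ (⊤ : ℕ∞) g₂) (hh₂ : ContDiff ℝ (⊤ : ℕ∞) h₂)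
    (hk₂ : ContDiff ℝ (⊤ : ℕ∞) k₂) (hl₂ : ContDiff ℝ (⊤ : ℕ∞) l₂) :
    ∃ f₃ g₃ h₃ k₃ l₃ : ℝ → ℝ,
      ContDiff ℝ (⊤ : ℕ∞) f₃ ∧ ContDiff ℝ (⊤ : ℕ∞) g₃ ∧ ContDiff ℝ (⊤ : ℕ∞) h₃ ∧
      ContDiff ℝ (⊤ : ℕ∞) k₃ ∧ ContDiff ℝ (⊤ : ℕ∞) l₃ ∧
      ∀ p : E,
        lie (fun q => Tf f₁ q + Yf g₁ q + Xf h₁ q + Wf k₁ q + Uf l₁ q)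
            (fun q => Tf f₂ q + Yf g₂ q + Xf h₂ q + Wf k₂ q + Uf l₂ q) p
          = Tf f₃ p + Yf g₃ p + Xf h₃ p + Wf k₃ p + Uf l₃ p := by
  let f₃ : ℝ → ℝ := fun t =>
    f₁ t * deriv f₂ t - deriv f₁ t * f₂ t
  let g₃ : ℝ → ℝ := fun t =>
    2/3 * deriv f₂ t * g₁ t - 2/3 * deriv f₁ t * g₂ t + f₁ t * deriv g₂ t
        - f₂ t * deriv g₁ t
  let h₃ : ℝ → ℝ := fun t =>
    1/3 * deriv f₂ t * h₁ t - 1/3 * deriv f₁ t * h₂ t + 2/3 * g₁ t * deriv g₂ t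
        - 2/3 * deriv g₁ t * g₂ t + f₁ t * deriv h₂ t - f₂ t * deriv h₁ t
  let k₃ : ℝ → ℝ := fun t =>
    -4/9 * deriv (deriv g₂) t * h₁ t - 4/9 * deriv g₁ t * deriv h₂ t
        + 4/9 * deriv (deriv g₁) t * h₂ t + 4/9 * deriv g₂ t * deriv h₁ t
        - 8/9 * g₁ t * deriv (deriv h₂) t + deriv f₁ t * k₂ t
        + 8/9 * g₂ t * deriv (deriv h₁) t - deriv f₂ t * k₁ t + f₁ t * deriv k₂ t
        - f₂ t * deriv k₁ t
  let l₃ : ℝ → ℝ := fun t =>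
    -2/3 * h₁ t * deriv h₂ t + 2/3 * deriv h₁ t * h₂ t + g₁ t * k₂ t - g₂ t * k₁ t
        + f₁ t * deriv l₂ t - f₂ t * deriv l₁ t - 1/3 * deriv f₂ t * l₁ t
        + 1/3 * deriv f₁ t * l₂ t
  have df1 : deriv f₃ = fun t =>
      f₁ t * deriv (deriv f₂) t - deriv (deriv f₁) t * f₂ t := by
    funext t
    simp (disch := fun_prop) only [f₃, deriv_sub_of_contDiff_infty, deriv_mul_of_contDiff_infty]
    ring
  have df2 : deriv (deriv f₃) = fun t =>
      deriv f₁ t * deriv (deriv f₂) t + f₁ t * deriv (deriv (deriv f₂)) t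
        - deriv (deriv (deriv f₁)) t * f₂ t - deriv (deriv f₁) t * deriv f₂ t := by
    rw [df1]
    funext t
    simp (disch := fun_prop) only [deriv_sub_of_contDiff_infty, deriv_mul_of_contDiff_infty]
    ring
  have df3 : deriv (deriv (deriv f₃)) = fun t =>
      2 * deriv f₁ t * deriv (deriv (deriv f₂)) t
        + f₁ t * deriv (deriv (deriv (deriv f₂))) t
        - deriv (deriv (deriv (deriv f₁))) t * f₂ t
        - 2 * deriv (deriv (deriv f₁)) t * deriv f₂ t := by
    rw [df2]
    funext t
    simp (disch := fun_prop) only [deriv_add_of_contDiff_infty, deriv_sub_of_contDiff_infty,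
      deriv_mul_of_contDiff_infty]
    ring
  have df4 : deriv (deriv (deriv (deriv f₃))) = fun t =>
      2 * deriv (deriv f₁) t * deriv (deriv (deriv f₂)) t
        + 3 * deriv f₁ t * deriv (deriv (deriv (deriv f₂))) t
        + f₁ t * deriv (deriv (deriv (deriv (deriv f₂)))) t
        - deriv (deriv (deriv (deriv (deriv f₁)))) t * f₂ t
        - 3 * deriv (deriv (deriv (deriv f₁))) t * deriv f₂ t
        - 2 * deriv (deriv (deriv f₁)) t * deriv (deriv f₂) t := by
    rw [df3]
    funext t
    simp (disch := fun_prop) only [deriv_add_of_contDiff_infty, deriv_sub_of_contDiff_infty,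
      deriv_mul_of_contDiff_infty, deriv_const_mul_field]
    ring
  have dg1 : deriv g₃ = fun t =>
      2/3 * deriv (deriv f₂) t * g₁ t - 1/3 * deriv f₂ t * deriv g₁ t
        - 2/3 * deriv (deriv f₁) t * g₂ t + 1/3 * deriv f₁ t * deriv g₂ t
        + f₁ t * deriv (deriv g₂) t - f₂ t * deriv (deriv g₁) t := by
    funext t
    simp (disch := fun_prop) only [g₃, deriv_add_of_contDiff_infty, deriv_sub_of_contDiff_infty,
      deriv_mul_of_contDiff_infty, deriv_const_mul_field]
    ring
  have dg2 : deriv (deriv g₃) = fun t =>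
      2/3 * deriv (deriv (deriv f₂)) t * g₁ t + 1/3 * deriv (deriv f₂) t * deriv g₁ t
        - 4/3 * deriv f₂ t * deriv (deriv g₁) t
        - 2/3 * deriv (deriv (deriv f₁)) t * g₂ t
        - 1/3 * deriv (deriv f₁) t * deriv g₂ t
        + 4/3 * deriv f₁ t * deriv (deriv g₂) t + f₁ t * deriv (deriv (deriv g₂)) t
        - f₂ t * deriv (deriv (deriv g₁)) t := by
    rw [dg1]
    funext t
    simp (disch := fun_prop) only [deriv_add_of_contDiff_infty, deriv_sub_of_contDiff_infty,
      deriv_mul_of_contDiff_infty, deriv_const_mul_field]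
    ring
  have dg3 : deriv (deriv (deriv g₃)) = fun t =>
      2/3 * deriv (deriv (deriv (deriv f₂))) t * g₁ t
        + deriv (deriv (deriv f₂)) t * deriv g₁ t
        - deriv (deriv f₂) t * deriv (deriv g₁) t
        - 7/3 * deriv f₂ t * deriv (deriv (deriv g₁)) t
        - 2/3 * deriv (deriv (deriv (deriv f₁))) t * g₂ t
        - deriv (deriv (deriv f₁)) t * deriv g₂ t
        + deriv (deriv f₁) t * deriv (deriv g₂) t
        + 7/3 * deriv f₁ t * deriv (deriv (deriv g₂)) t
        + f₁ t * deriv (deriv (deriv (deriv g₂))) t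
        - f₂ t * deriv (deriv (deriv (deriv g₁))) t := by
    rw [dg2]
    funext t
    simp (disch := fun_prop) only [deriv_add_of_contDiff_infty, deriv_sub_of_contDiff_infty,
      deriv_mul_of_contDiff_infty, deriv_const_mul_field]
    ring
  have dh1 : deriv h₃ = fun t =>
      1/3 * deriv (deriv f₂) t * h₁ t - 2/3 * deriv f₂ t * deriv h₁ t
        - 1/3 * deriv (deriv f₁) t * h₂ t + 2/3 * deriv f₁ t * deriv h₂ t
        + 2/3 * g₁ t * deriv (deriv g₂) t - 2/3 * deriv (deriv g₁) t * g₂ t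
        + f₁ t * deriv (deriv h₂) t - f₂ t * deriv (deriv h₁) t := by
    funext t
    simp (disch := fun_prop) only [h₃, deriv_add_of_contDiff_infty, deriv_sub_of_contDiff_infty,
      deriv_mul_of_contDiff_infty, deriv_const_mul_field]
    ring
  have dh2 : deriv (deriv h₃) = fun t =>
      1/3 * deriv (deriv (deriv f₂)) t * h₁ t - 1/3 * deriv (deriv f₂) t * deriv h₁ t
        - 5/3 * deriv f₂ t * deriv (deriv h₁) t
        - 1/3 * deriv (deriv (deriv f₁)) t * h₂ t
        + 1/3 * deriv (deriv f₁) t * deriv h₂ t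
        + 5/3 * deriv f₁ t * deriv (deriv h₂) t
        + 2/3 * deriv g₁ t * deriv (deriv g₂) t
        + 2/3 * g₁ t * deriv (deriv (deriv g₂)) t
        - 2/3 * deriv (deriv (deriv g₁)) t * g₂ t
        - 2/3 * deriv (deriv g₁) t * deriv g₂ t + f₁ t * deriv (deriv (deriv h₂)) t
        - f₂ t * deriv (deriv (deriv h₁)) t := by
    rw [dh1]
    funext t
    simp (disch := fun_prop) only [deriv_add_of_contDiff_infty, deriv_sub_of_contDiff_infty,
      deriv_mul_of_contDiff_infty, deriv_const_mul_field]
    ring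
  refine ⟨f₃, g₃, h₃, k₃, l₃, by fun_prop, by fun_prop, by fun_prop, by fun_prop, by fun_prop, ?_⟩
  rintro ⟨x, y, t, w⟩
  rw [lie, fderiv_symmetryField hf₂ hg₂ hh₂ hk₂ hl₂, fderiv_symmetryField hf₁ hg₁ hh₁ hk₁ hl₁,
    fderiv_Tf hf₁, fderiv_Tf hf₂, fderiv_Yf hg₁, fderiv_Yf hg₂, fderiv_Xf hh₁, fderiv_Xf hh₂,
    fderiv_Wf hk₁, fderiv_Wf hk₂, fderiv_Uf hl₁, fderiv_Uf hl₂]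
  simp only [Tf, Yf, Xf, Wf, Uf, Prod.mk_add_mk, Prod.mk_sub_mk, Function.iterate_succ,
    Function.iterate_zero, Function.comp_apply, id_eq, Prod.mk.injEq]
  rw [df4, df3, df2, df1, dg3, dg2, dg1, dh2, dh1]
  simp only [f₃, g₃, h₃, k₃, l₃]
  refine ⟨?_, ?_, ?_, ?_⟩ <;> ring
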